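/- Let q be a power of an odd prime and let A = 𝔽_q[T]. Let α = [[a, b], [c, d]] ∈ SL₂(A), let ε be a nonzero element of 𝔽_q, and let r be a positive integer such that b divides a^r − ε in A. Then α^r = diag(ε, ε⁻¹) · χ₅ · γ · χ₄ · β · χ₃ for some χ₃ ∈ F₃(A³), χ₄ ∈ G₄(A⁴), χ₅ ∈ G₅(A⁵), γ ∈ M_Λᵀ, and β ∈ M_Λ, where diag(ε, ε⁻¹) = [[ε, 0], [0, ε⁻¹]]. -/

import Mathlib

open Polynomial Matrix

/-- The elementary matrix `m_{12} = [[1, m], [0, 1]]`. -/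
def m₁₂ {R : Type*} [CommRing R] (m : R) : Matrix (Fin 2) (Fin 2) R := !![1, m; 0, 1]

/-- The elementary matrix `m_{21} = [[1, 0], [m, 1]]`. -/
def m₂₁ {R : Type*} [CommRing R] (m : R) : Matrix (Fin 2) (Fin 2) R := !![1, 0; m, 1]

/-- The matrix `J = [[0, 1], [−1, 0]]`. -/
def Jmat (R : Type*) [CommRing R] : Matrix (Fin 2) (Fin 2) R := !![0, 1; -1, 0]

/-- `F_r(m₁, …, m_r)`: the alternating product whose `k`-th factor (k = 1, …, r) is
`(m_k)_{12}` for odd `k` and `(m_k)_{21}` for even `k`. -/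
def Fmat {R : Type*} [CommRing R] (r : ℕ) (m : Fin r → R) : Matrix (Fin 2) (Fin 2) R :=
  ((List.finRange r).map (fun k => if k.val % 2 = 0 then m₁₂ (m k) else m₂₁ (m k))).prod

/-- `G_r(m₁, …, m_r) = J · F_r(m₁, …, m_r) · J⁻¹`. -/
noncomputable def Gmat {R : Type*} [CommRing R] (r : ℕ) (m : Fin r → R) :
    Matrix (Fin 2) (Fin 2) R :=
  Jmat R * Fmat r m * (Jmat R)⁻¹

/-- `F_r(A^r)`: the set of values of `F_r` as `m₁, …, m_r` range over `R`. -/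
def FSet (R : Type*) [CommRing R] (r : ℕ) : Set (Matrix (Fin 2) (Fin 2) R) :=
  Set.range (fun m : Fin r → R => Fmat r m)

/-- `G_r(A^r)`: the set of values of `G_r` as `m₁, …, m_r` range over `R`. -/
def GSet (R : Type*) [CommRing R] (r : ℕ) : Set (Matrix (Fin 2) (Fin 2) R) :=
  Set.range (fun m : Fin r → R => Gmat r m)


/-- The set `M_Λ` of products `[[1+ae, be²], [c, 1+de]] · [[1+ae, ce²], [b, 1+de]]`
with `a, b, c, d, e ∈ R` such that the first factor has determinant `1`. -/
def MLambda (R : Type*) [CommRing R] : Set (Matrix (Fin 2) (Fin 2) R) :=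
  {x | ∃ a b c d e : R,
    (!![1 + a * e, b * e ^ 2; c, 1 + d * e] : Matrix (Fin 2) (Fin 2) R).det = 1 ∧
    x = !![1 + a * e, b * e ^ 2; c, 1 + d * e] * !![1 + a * e, c * e ^ 2; b, 1 + d * e]}

/-- `M_Λᵀ`: the set of transposes of elements of `M_Λ`. -/
def MLambdaT (R : Type*) [CommRing R] : Set (Matrix (Fin 2) (Fin 2) R) :=
  {x | ∃ y ∈ MLambda R, x = yᵀ}

/-- Over a finite field of odd order, the form `w² + a v²` with `a ≠ 0` represents everything. -/
theorem FiniteField.exists_sq_add_mul_sq {K : Type*} [Field K] [Finite K]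
    (h2 : (2 : K) ≠ 0) {a : K} (ha : a ≠ 0) (b : K) :
    ∃ w v : K, w ^ 2 + a * v ^ 2 = b := by
  have := Fintype.ofFinite K
  have hodd : Fintype.card K % 2 = 1 :=
    FiniteField.odd_card_of_char_ne_two fun h => h2 (by
      have := ringChar.Nat.cast_ringChar (R := K)
      rwa [h, Nat.cast_ofNat] at this)
  obtain ⟨w, v, h⟩ := FiniteField.exists_root_sum_quadratic (R := K)
    (f := X ^ 2) (g := C a * X ^ 2 + C 0 * X + C (-b)) (degree_X_pow 2)
    (degree_quadratic ha) hodd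
  refine ⟨w, v, ?_⟩
  simp only [eval_pow, eval_X, eval_add, eval_mul, eval_C] at h
  linear_combination h

/-- Solving a linear congruence modulo a prime polynomial. -/
theorem exists_dvd_mul_add {F : Type*} [Field F] {π u : F[X]} (hπ : Prime π) (hu : ¬π ∣ u)
    (k : F[X]) :
    ∃ s, π ∣ u * s + k := by
  obtain ⟨x, y, h⟩ := (hπ.irreducible.coprime_iff_not_dvd.2 hu)
  exact ⟨-y * k, x * k, by linear_combination -k * h⟩

section BinaryForm

variable {F : Type*} [Field F] [Finite F]

theorem exists_sq_add_mul_sq_mod_prime (h2 : (2 : F) ≠ 0) {π a : F[X]} (hπ : Prime π)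
    (ha : ¬π ∣ a) (b : F[X]) : ∃ w v : F[X], π ∣ w ^ 2 + a * v ^ 2 - b := by
  have : Fact (Irreducible π) := ⟨hπ.irreducible⟩
  have : FiniteDimensional F (AdjoinRoot π) := (AdjoinRoot.powerBasis hπ.ne_zero).finite
  have : Finite (AdjoinRoot π) := Module.finite_of_finite F
  have h2' : (2 : AdjoinRoot π) ≠ 0 := by
    rw [← map_ofNat (algebraMap F (AdjoinRoot π)) 2]
    exact (_root_.map_ne_zero _).2 h2
  obtain ⟨w, v, h⟩ := FiniteField.exists_sq_add_mul_sq h2'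
    (a := AdjoinRoot.mk π a) (by rwa [Ne, AdjoinRoot.mk_eq_zero]) (AdjoinRoot.mk π b)
  obtain ⟨w, rfl⟩ := AdjoinRoot.mk_surjective w
  obtain ⟨v, rfl⟩ := AdjoinRoot.mk_surjective v
  refine ⟨w, v, AdjoinRoot.mk_eq_zero.1 ?_⟩
  simp [h]

theorem exists_sq_add_mul_sq_mod_prime_pow (h2 : (2 : F) ≠ 0) {π a b : F[X]} (hπ : Prime π)
    (ha : ¬π ∣ a) (hb : ¬π ∣ b) (i : ℕ) : ∃ w v : F[X], π ^ (i + 1) ∣ w ^ 2 + a * v ^ 2 - b := by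
  have hπ2 : ¬π ∣ 2 := fun h => hπ.not_isUnit <| isUnit_of_dvd_unit h <| by
    rw [← map_ofNat C 2]
    exact isUnit_C.2 (IsUnit.mk0 _ h2)
  induction i with
  | zero => simpa using exists_sq_add_mul_sq_mod_prime h2 hπ ha b
  | succ i ih =>
    obtain ⟨w, v, k, hk⟩ := ih
    by_cases hw : π ∣ w
    · have hv : ¬π ∣ v := fun hv => hb <| by
        have : b = w * w + a * v * v - π ^ (i + 1) * k := by linear_combination -hk
        rw [this]
        exact dvd_sub (dvd_add (hw.mul_left _) (hv.mul_left _))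
          (dvd_mul_of_dvd_left (dvd_pow_self _ i.succ_ne_zero) _)
      obtain ⟨s, l, hs⟩ := exists_dvd_mul_add hπ (u := 2 * a * v) (k := k) <| by
        simp only [hπ.dvd_mul]; tauto
      exact ⟨w, v + π ^ (i + 1) * s, l + a * π ^ i * s ^ 2, by
        linear_combination hk + π ^ (i + 1) * hs⟩
    · obtain ⟨s, l, hs⟩ := exists_dvd_mul_add hπ (u := 2 * w) (k := k) <| by
        simp only [hπ.dvd_mul]; tauto
      exact ⟨w + π ^ (i + 1) * s, v, l + π ^ i * s ^ 2, by
        linear_combination hk + π ^ (i + 1) * hs⟩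

theorem exists_sq_add_mul_sq_mod (h2 : (2 : F) ≠ 0) {p a b : F[X]} (hp : p ≠ 0)
    (ha : IsCoprime p a) (hb : IsCoprime p b) : ∃ w v : F[X], p ∣ w ^ 2 + a * v ^ 2 - b := by
  induction p using UniqueFactorizationMonoid.induction_on_coprime with
  | h0 => exact absurd rfl hp
  | h1 hx => exact ⟨0, 0, hx.dvd⟩
  | hpr i hπ =>
    rcases i with _ | i
    · exact ⟨0, 0, by simp⟩
    · rw [IsCoprime.pow_left_iff i.succ_pos, hπ.irreducible.coprime_iff_not_dvd] at ha hb
      exact exists_sq_add_mul_sq_mod_prime_pow h2 hπ ha hb i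
  | hcp hxy hx hy =>
    rename_i x y
    obtain ⟨w, v, h⟩ := hx (left_ne_zero_of_mul hp) ha.of_mul_left_left hb.of_mul_left_left
    obtain ⟨w', v', h'⟩ := hy (right_ne_zero_of_mul hp) ha.of_mul_left_right hb.of_mul_left_right
    obtain ⟨c, d, hcd⟩ := hxy.isCoprime
    refine ⟨w + c * x * (w' - w), v + c * x * (v' - v), hxy.isCoprime.mul_dvd ?_ ?_⟩
    · obtain ⟨k, hk⟩ := h
      exact ⟨k + c * (w' - w) * (2 * w + c * x * (w' - w))
        + a * c * (v' - v) * (2 * v + c * x * (v' - v)), by linear_combination hk⟩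
    · obtain ⟨k, hk⟩ := h'
      refine ⟨k - d * (w' - w) * (2 * w' - d * y * (w' - w))
        - a * d * (v' - v) * (2 * v' - d * y * (v' - v)), ?_⟩
      have e : c * x = 1 - d * y := by linear_combination hcd
      rw [e]
      linear_combination hk

end BinaryForm

/-- Shifting `w` by a multiple of `p` makes it coprime to `v`, provided that no prime divides
all of `w`, `p` and `v`. -/
theorem exists_isCoprime_add_mul {R : Type*} [CommRing R] [IsDomain R] [IsPrincipalIdealRing R]
    {w p v : R} (hv : v ≠ 0) (h : ∀ π, Prime π → π ∣ w → π ∣ p → ¬π ∣ v) :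
    ∃ s, IsCoprime (w + p * s) v := by
  induction v using UniqueFactorizationMonoid.induction_on_prime with
  | h₁ => exact absurd rfl hv
  | h₂ x hx => exact let ⟨c, hc⟩ := hx.exists_left_inv; ⟨0, 0, c, by simp [hc]⟩
  | h₃ v π hv0 hπ ih =>
    obtain ⟨s, hs⟩ := ih hv0 fun ρ hρ hw hp hρv => h ρ hρ hw hp (hρv.mul_left _)
    by_cases hd : π ∣ w + p * s
    · have hπv : ¬π ∣ v := fun hπv => hπ.not_isUnit (hs.isUnit_of_dvd' hd hπv)
      have hπp : ¬π ∣ p := fun hπp =>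
        h π hπ ((dvd_add_left (hπp.mul_right s)).1 hd) hπp (dvd_mul_right _ _)
      have hadd : w + p * (s + v) = (w + p * s) + v * p := by ring
      refine ⟨s + v, IsCoprime.mul_right ?_ ?_⟩
      · rw [isCoprime_comm, hπ.irreducible.coprime_iff_not_dvd, hadd, dvd_add_right hd,
          hπ.dvd_mul]
        tauto
      · rw [hadd]
        exact hs.add_mul_left_left p
    · exact ⟨s, IsCoprime.mul_right
        (isCoprime_comm.1 (hπ.irreducible.coprime_iff_not_dvd.2 hd)) hs⟩

/-- Every invertible residue class modulo `p` contains a polynomial modulo which `-a` is a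
square. -/
theorem exists_add_mul_eq_neg_sq {F : Type*} [Field F] [Finite F] (h2 : (2 : F) ≠ 0)
    {p a b : F[X]} (ha : IsCoprime p a) (hb : IsCoprime p b) :
    ∃ m n f : F[X], a + n * (b + m * p) = -f ^ 2 := by
  rcases eq_or_ne p 0 with rfl | hp
  · obtain ⟨c, hc⟩ := (isCoprime_zero_left.1 hb).exists_left_inv
    exact ⟨0, -a * c, 0, by linear_combination -a * hc⟩
  obtain ⟨w, v, hv, k, hk⟩ : ∃ w v : F[X], v ≠ 0 ∧ p ∣ w ^ 2 + a * v ^ 2 - b := by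
    obtain ⟨w, v, hwv⟩ := exists_sq_add_mul_sq_mod h2 hp ha hb
    rcases eq_or_ne v 0 with rfl | hv
    · refine ⟨w, p, hp, ?_⟩
      obtain ⟨k, hk⟩ := hwv
      exact ⟨k + a * p, by linear_combination hk⟩
    · exact ⟨w, v, hv, hwv⟩
  obtain ⟨s, hs⟩ := exists_isCoprime_add_mul (w := w) (p := p) hv fun π hπ hw hπp hπv =>
    hπ.not_isUnit <| hb.isUnit_of_dvd' hπp <| by
      have : b = w * w + a * v * v - p * k := by linear_combination -hk
      rw [this]
      exact dvd_sub (dvd_add (hw.mul_left _) (hπv.mul_left _)) (hπp.mul_right _)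
  set y := w + p * s with hy
  have hvy : IsCoprime v (y ^ 2 + a * v ^ 2) := by
    rw [show a * v ^ 2 = v * (a * v) by ring]
    exact (isCoprime_comm.1 (hs.pow_left (m := 2))).add_mul_left_right (a * v)
  obtain ⟨c, d, hcd⟩ := hvy
  set b' := y ^ 2 + a * v ^ 2 with hb'
  refine ⟨k + 2 * w * s + p * s ^ 2, -c ^ 2 - a * d * (2 - d * b'), c * y, ?_⟩
  have hbb : b + (k + 2 * w * s + p * s ^ 2) * p = b' := by
    rw [hb', hy]; linear_combination -hk
  rw [hbb]
  linear_combination (-a * (c * v + 1 - d * b')) * hcd + c ^ 2 * hb'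

theorem Matrix.fin_two_eq {R : Type*} {a b c d a' b' c' d' : R} (ha : a = a') (hb : b = b')
    (hc : c = c') (hd : d = d') : !![a, b; c, d] = !![a', b'; c', d'] := by
  rw [ha, hb, hc, hd]

section Matrices

variable {R : Type*} [CommRing R]

theorem m₁₂_mul_m₁₂ (m n : R) : m₁₂ m * m₁₂ n = m₁₂ (m + n) := by
  simp [m₁₂, add_comm]

theorem mul_m₁₂_mem_FSet_three (m₁ m₂ m₃ : R) : m₁₂ m₁ * m₂₁ m₂ * m₁₂ m₃ ∈ FSet R 3 :=
  ⟨![m₁, m₂, m₃], by simp [Fmat, List.finRange_succ, mul_assoc]⟩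

theorem Jmat_inv : (Jmat R)⁻¹ = -Jmat R := by
  refine Matrix.inv_eq_right_inv ?_
  simp [Jmat, Matrix.one_fin_two]

theorem Jmat_mul_mul_Jmat_inv (a b c d : R) :
    Jmat R * !![a, b; c, d] * (Jmat R)⁻¹ = !![d, -c; -b, a] := by
  rw [Jmat_inv]
  simp [Jmat]

theorem Jmat_mul_m₁₂_mul_Jmat_inv (m : R) : Jmat R * m₁₂ m * (Jmat R)⁻¹ = m₂₁ (-m) := by
  simp [m₁₂, m₂₁, Jmat_mul_mul_Jmat_inv]

theorem Jmat_mul_m₂₁_mul_Jmat_inv (m : R) : Jmat R * m₂₁ m * (Jmat R)⁻¹ = m₁₂ (-m) := by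
  simp [m₁₂, m₂₁, Jmat_mul_mul_Jmat_inv]

theorem Jmat_inv_mul_Jmat : (Jmat R)⁻¹ * Jmat R = 1 := by
  rw [Jmat_inv]
  simp [Jmat, Matrix.one_fin_two]

/-- Conjugation by `J` is multiplicative. -/
theorem Jmat_conj_mul (x y : Matrix (Fin 2) (Fin 2) R) :
    Jmat R * (x * y) * (Jmat R)⁻¹ = (Jmat R * x * (Jmat R)⁻¹) * (Jmat R * y * (Jmat R)⁻¹) := by
  calc Jmat R * (x * y) * (Jmat R)⁻¹
      = Jmat R * x * ((Jmat R)⁻¹ * Jmat R) * y * (Jmat R)⁻¹ := by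
        rw [Jmat_inv_mul_Jmat]; simp only [mul_assoc, one_mul]
    _ = _ := by simp only [mul_assoc]

theorem Jmat_conj_mem_GSet_four (m₁ m₂ m₃ m₄ : R) :
    Jmat R * (m₁₂ m₁ * m₂₁ m₂ * m₁₂ m₃ * m₂₁ m₄) * (Jmat R)⁻¹ ∈ GSet R 4 :=
  ⟨![m₁, m₂, m₃, m₄], by simp [Gmat, Fmat, List.finRange_succ, mul_assoc]⟩

theorem mul_m₂₁_mem_GSet_five (m₁ m₂ m₃ m₄ m₅ : R) :
    m₂₁ m₁ * m₁₂ m₂ * m₂₁ m₃ * m₁₂ m₄ * m₂₁ m₅ ∈ GSet R 5 := by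
  refine ⟨![-m₁, -m₂, -m₃, -m₄, -m₅], ?_⟩
  have : Fmat 5 ![-m₁, -m₂, -m₃, -m₄, -m₅] =
      m₁₂ (-m₁) * m₂₁ (-m₂) * m₁₂ (-m₃) * m₂₁ (-m₄) * m₁₂ (-m₅) := by
    simp [Fmat, List.finRange_succ, mul_assoc]
  simp only [Gmat, this, Jmat_conj_mul, Jmat_mul_m₁₂_mul_Jmat_inv, Jmat_mul_m₂₁_mul_Jmat_inv,
    neg_neg]

/-- Elements of `M_Λ`, with the congruence `p ≡ 1 mod e` relaxed to `p ≡ ±1 mod e`. -/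
theorem mul_mem_MLambda {p p' b c e η : R} (hη : η = 1 ∨ η = -1) (hdet : p * p' - b * c * e ^ 2 = 1)
    (he : e ∣ p - η) :
    !![p, b * e ^ 2; c, p'] * !![p, c * e ^ 2; b, p'] ∈ MLambda R := by
  obtain ⟨k, hk⟩ := he
  obtain ⟨k', hk'⟩ : e ∣ p' - η := by
    refine ⟨η * (b * c * e - k * p'), ?_⟩
    rcases hη with rfl | rfl
    · linear_combination hdet - p' * hk
    · linear_combination -hdet + p' * hk
  obtain rfl : p = η + e * k := by linear_combination hk
  obtain rfl : p' = η + e * k' := by linear_combination hk'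
  refine ⟨η * k, η * b, η * c, η * k', e, ?_, ?_⟩
  · rw [Matrix.det_fin_two_of]
    rcases hη with rfl | rfl <;> linear_combination hdet
  · rw [Matrix.mul_fin_two, Matrix.mul_fin_two]
    rcases hη with rfl | rfl <;> apply Matrix.fin_two_eq <;> ring

/-- Swindling: up to conjugation by `J` and a factor from `M_Λ`, the factor `e²` moves from one
off-diagonal entry to the other. -/
theorem exists_mem_MLambda_eq_conj_mul {p p' b c e η : R} (hη : η = 1 ∨ η = -1)
    (hdet : p * p' - b * c * e ^ 2 = 1) (he : e ∣ p - η) :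
    ∃ β ∈ MLambda R, !![p, b * e ^ 2; c, p'] =
      Jmat R * !![p, b; c * e ^ 2, p'] * (Jmat R)⁻¹ * β := by
  refine ⟨_, mul_mem_MLambda hη (p' := p') (b := c) (c := b) (by linear_combination hdet) he, ?_⟩
  rw [Jmat_mul_mul_Jmat_inv]
  simp only [Matrix.mul_fin_two]
  apply Matrix.fin_two_eq
  · linear_combination (-p) * hdet
  · linear_combination (-(b * e ^ 2)) * hdet
  · linear_combination (-c) * hdet
  · linear_combination (-p') * hdet

/-- The transposed form of swindling. -/
theorem exists_mem_MLambdaT_conj_eq_mul {p p' b c e η : R} (hη : η = 1 ∨ η = -1)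
    (hdet : p * p' - b * c * e ^ 2 = 1) (he : e ∣ p - η) :
    ∃ γ ∈ MLambdaT R, Jmat R * !![p, b * e ^ 2; c, p'] * (Jmat R)⁻¹ =
      !![p, b; c * e ^ 2, p'] * γ := by
  have he' : e ∣ p' - η := by
    obtain ⟨k, hk⟩ := he
    refine ⟨η * (b * c * e - k * p'), ?_⟩
    rcases hη with rfl | rfl
    · linear_combination hdet - p' * hk
    · linear_combination -hdet + p' * hk
  refine ⟨_, ⟨_, mul_mem_MLambda hη (p := p') (p' := p) (b := -b) (c := -c)
    (by linear_combination hdet) he', rfl⟩, ?_⟩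
  rw [Jmat_mul_mul_Jmat_inv, Matrix.transpose_mul]
  have htr : ∀ a b c d : R, !![a, b; c, d]ᵀ = !![a, c; b, d] := fun a b c d => by
    ext i j; fin_cases i <;> fin_cases j <;> rfl
  simp only [htr, Matrix.mul_fin_two]
  apply Matrix.fin_two_eq
  · linear_combination (-p') * hdet
  · linear_combination c * hdet
  · linear_combination (b * e ^ 2) * hdet
  · linear_combination (-p) * hdet

/-- Powers of a matrix in `SL₂` are linear combinations `s + t α` with coefficients of norm one. -/
theorem exists_pow_fin_two_eq {a b c d : R} (hdet : a * d - b * c = 1) (r : ℕ) :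
    ∃ s t : R, !![a, b; c, d] ^ r = !![s + t * a, t * b; t * c, s + t * d] ∧
      s ^ 2 + s * t * (a + d) + t ^ 2 = 1 ∧ b ∣ s + t * a - a ^ r := by
  induction r with
  | zero => exact ⟨1, 0, by simp [Matrix.one_fin_two], by ring, by simp⟩
  | succ r ih =>
    obtain ⟨s, t, hpow, hnorm, k, hk⟩ := ih
    refine ⟨-t, s + t * (a + d), ?_, by linear_combination hnorm, a * k + t * c, ?_⟩
    · rw [pow_succ, hpow, Matrix.mul_fin_two]
      apply Matrix.fin_two_eq
      · linear_combination (-t) * hdet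
      · ring
      · ring
      · linear_combination (-t) * hdet
    · rw [pow_succ]
      linear_combination a * hk + t * hdet

/-- A matrix in `SL₂` whose first row is `(u + b j, b)` for a unit `u` is a product of a diagonal
matrix and three elementary ones. -/
theorem eq_diagonal_mul_elementary {u v b c d j : R} (huv : u * v = 1)
    (hdet : (u + b * j) * d - b * c = 1) :
    !![u + b * j, b; c, d] =
      !![u, 0; 0, v] * (m₂₁ (u * (c - j * d)) * m₁₂ (v * b) * m₂₁ j) := by
  simp only [m₁₂, m₂₁, Matrix.mul_fin_two]
  apply Matrix.fin_two_eq
  · linear_combination (-b * j) * huv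
  · linear_combination (-b) * huv
  · linear_combination
      (-(c - j * d) - j * (d + v * (c - j * d) * b)) * huv + j * v * hdet
  · linear_combination (-d - v * (c - j * d) * b) * huv + v * hdet

end Matrices

/-- A factor `e` of the entry `e * b` can be removed at the cost of one swindle and five
elementary factors if the entry to its left is `±1` modulo `e`. -/
theorem exists_swindle_removing_factor {F : Type*} [Field F] [Finite F] (h2 : (2 : F) ≠ 0)
    {p e b c d η : F[X]} (hη : η = 1 ∨ η = -1) (hdet : p * d - e * b * c = 1) (he : e ∣ p - η) :
    ∃ P P' B Q E m₁ m₂ m₃ n₁ n₂ c' d' : F[X],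
      P * P' - B * Q * E ^ 2 = 1 ∧ E ∣ P - η ∧ p * d' - b * c' = 1 ∧
      !![p, e * b; c, d] = !![P, B * E ^ 2; Q, P'] * (m₁₂ m₁ * m₂₁ m₂ * m₁₂ m₃) ∧
      !![P, B; Q * E ^ 2, P'] = !![p, b; c', d'] * (m₁₂ n₁ * m₂₁ n₂) := by
  have hη2 : η * η = 1 := by rcases hη with rfl | rfl <;> ring
  obtain ⟨k, hk⟩ := he
  obtain ⟨m, n, f, hf⟩ := exists_add_mul_eq_neg_sq h2 (p := p) (a := η * k) (b := b)
    ⟨η, -e, by linear_combination η * hk + hη2⟩ ⟨d, -(e * c), by linear_combination hdet⟩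
  set B := b + m * p with hB
  set P := p + η * n * (e * B) with hP
  set d₁ := d + e * m * c with hd₁
  set Q := c + η * n * d₁ with hQ
  set P' := d₁ - η * e * B * Q with hP'
  have hPη : P = η - η * e * f ^ 2 := by
    linear_combination hP + hk + η * e * hf - e * k * hη2
  have hBE : e * B - η * e * B * P = B * (e * f) ^ 2 := by
    rw [hPη]; linear_combination (-e * B * (1 - e * f ^ 2)) * hη2
  have hW : P * P' - B * Q * (e * f) ^ 2 = 1 := by
    linear_combination hdet + P * hP' + Q * hBE + d₁ * hP - e * B * hQ + p * hd₁ - e * c * hB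
  refine ⟨P, P', B, Q, e * f, η * e * B, -(η * n), -(e * m), m, η * n * e,
    Q * (e * f) ^ 2 - η * n * e * P', P' - m * (Q * (e * f) ^ 2 - η * n * e * P'), hW,
    ⟨-η * f, by rw [hPη]; ring⟩, ?_, ?_, ?_⟩
  · linear_combination hW - (P' - m * (Q * (e * f) ^ 2 - η * n * e * P')) * hP
      + (Q * (e * f) ^ 2 - η * n * e * P') * hB
  · rw [← hBE]
    simp only [m₁₂, m₂₁, Matrix.mul_fin_two]
    apply Matrix.fin_two_eq <;> simp only [hP', hQ, hP, hd₁, hB] <;> ring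
  · simp only [m₁₂, m₂₁, Matrix.mul_fin_two]
    apply Matrix.fin_two_eq <;> (try simp only [hP, hB]) <;> ring

/-- Corollary 3.5: with `A = 𝔽_q[T]` (`q` a power of an odd prime), let
`α = [[a, b], [c, d]] ∈ SL₂(A)`, let `ε ∈ 𝔽_q` be nonzero, and let `r ≥ 1` satisfy
`b ∣ a^r − ε`.  Then `α^r = diag(ε, ε⁻¹) · χ₅ · γ · χ₄ · β · χ₃` with
`χ₃ ∈ F₃(A³)`, `χ₄ ∈ G₄(A⁴)`, `χ₅ ∈ G₅(A⁵)`, `γ ∈ M_Λᵀ`, `β ∈ M_Λ`. -/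
theorem corollary_power_decomposition
    (F : Type) [Field F] [Fintype F] (hq : Odd (Fintype.card F))
    (a b c d : Polynomial F)
    (hdet : (!![a, b; c, d] : Matrix (Fin 2) (Fin 2) (Polynomial F)).det = 1)
    (ε : F) (hε : ε ≠ 0) (r : ℕ) (hr : 1 ≤ r) (hdvd : b ∣ a ^ r - C ε) :
    ∃ χ₃ ∈ FSet (Polynomial F) 3, ∃ χ₄ ∈ GSet (Polynomial F) 4,
      ∃ χ₅ ∈ GSet (Polynomial F) 5, ∃ γ ∈ MLambdaT (Polynomial F),
        ∃ β ∈ MLambda (Polynomial F),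
          (!![a, b; c, d] : Matrix (Fin 2) (Fin 2) (Polynomial F)) ^ r =
            !![C ε, 0; 0, C ε⁻¹] * χ₅ * γ * χ₄ * β * χ₃ := by
  have h2 : (2 : F) ≠ 0 := by
    refine Ring.two_ne_zero fun h => ?_
    rw [← Nat.not_even_iff_odd, Nat.even_iff] at hq
    exact hq (FiniteField.even_card_iff_char_two.mp h)
  rw [Matrix.det_fin_two_of] at hdet
  obtain ⟨s, t, hpow, hnorm, hx⟩ := exists_pow_fin_two_eq hdet r
  obtain ⟨t₁, t₂, ⟨k₁, hk₁⟩, ⟨k₂, hk₂⟩, rfl⟩ : ∃ t₁ t₂, t₁ ∣ s - 1 ∧ t₂ ∣ s + 1 ∧ t = t₁ * t₂ :=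
    exists_dvd_and_dvd_of_dvd_mul ⟨-(s * (a + d) + t), by linear_combination hnorm⟩
  obtain ⟨j, hj⟩ : b ∣ s + t₁ * t₂ * a - C ε := by
    convert dvd_add hx hdvd using 1
    ring
  set x := s + t₁ * t₂ * a with hxs
  obtain ⟨P, P', B, Q, E, m₁, m₂, m₃, n₁, n₂, c₁, d₁, hP, hPE, hdet₁, hα, hZ⟩ :=
    exists_swindle_removing_factor h2 (p := x) (e := t₁) (b := t₂ * b) (c := t₁ * t₂ * c)
      (d := s + t₁ * t₂ * d) (η := 1) (Or.inl rfl)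
      (by rw [hxs]; linear_combination hnorm + (t₁ * t₂) ^ 2 * hdet)
      ⟨k₁ + t₂ * a, by rw [hxs]; linear_combination hk₁⟩
  obtain ⟨N, N', D, S, H, m₁', m₂', m₃', n₁', n₂', c₂, d₂, hN, hNH, hdet₂, hY, hZ'⟩ :=
    exists_swindle_removing_factor h2 (p := x) (e := t₂) (b := b) (η := -1) (Or.inr rfl) hdet₁
      ⟨k₂ + t₁ * a, by rw [hxs]; linear_combination hk₂⟩
  obtain ⟨β, hβ, hWβ⟩ := exists_mem_MLambda_eq_conj_mul (Or.inl rfl) hP hPE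
  obtain ⟨γ, hγ, hWγ⟩ := exists_mem_MLambdaT_conj_eq_mul (Or.inr rfl) hN hNH
  have hx' : x = C ε + b * j := by linear_combination hj
  rw [hx'] at hdet₂
  refine ⟨_, mul_m₁₂_mem_FSet_three m₁ m₂ m₃, _,
    Jmat_conj_mem_GSet_four m₁' m₂' (m₃' + n₁) n₂, _,
    mul_m₂₁_mem_GSet_five (C ε * (c₂ - j * d₂)) (C ε⁻¹ * b) j n₁' n₂', γ, hγ, β, hβ, ?_⟩
  have hεinv : C ε * C ε⁻¹ = 1 := by rw [← C_mul, mul_inv_cancel₀ hε, C_1]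
  have hχ₄ : !![N, D * H ^ 2; S, N'] * (m₁₂ m₁' * m₂₁ m₂' * m₁₂ m₃') * (m₁₂ n₁ * m₂₁ n₂) =
      !![N, D * H ^ 2; S, N'] * (m₁₂ m₁' * m₂₁ m₂' * m₁₂ (m₃' + n₁) * m₂₁ n₂) := by
    simp only [← m₁₂_mul_m₁₂, mul_assoc]
  rw [hpow, mul_assoc t₁ t₂ b, hα, hWβ, hZ, hY, hχ₄, Jmat_conj_mul, hWγ, hZ', hx',
    eq_diagonal_mul_elementary hεinv hdet₂]
  simp only [mul_assoc]
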